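/- Under the convexity and qualification assumptions, (m₁,w,m₂,D) ∈ 𝓒 and (u,γ,P) ∈ 𝓚 are respectively solutions of (𝔓) and (𝔇) if and only if the conditions (C1)–(C7) hold. -/

import Mathlib

noncomputable section
open Finset Filter Topology Bornology
open scoped Classical Pointwise

/-- Fenchel conjugate of a function on a finite coordinate space. -/
def conjFn {d : Type*} [Fintype d] (g : (d → ℝ) → EReal) (y : d → ℝ) : EReal :=
  ⨆ x : d → ℝ, (↑(∑ i, x i * y i) : EReal) - g x

/-- Fenchel conjugate, scalar case. -/
def conjR (g : ℝ → EReal) (y : ℝ) : EReal :=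
  ⨆ x : ℝ, (↑(x * y) : EReal) - g x

/-- Subdifferential (empty where `g = ⊤`). -/
def subdiffFn {d : Type*} [Fintype d] (g : (d → ℝ) → EReal) (x : d → ℝ) : Set (d → ℝ) :=
  {p | g x ≠ ⊤ ∧ ∀ x', g x + (↑(∑ i, p i * (x' i - x i)) : EReal) ≤ g x'}

def subdiffR (g : ℝ → EReal) (x : ℝ) : Set ℝ :=
  {p | g x ≠ ⊤ ∧ ∀ x', g x + (↑(p * (x' - x)) : EReal) ≤ g x'}

def EProper {E : Type*} (g : E → EReal) : Prop := (∃ x, g x ≠ ⊤) ∧ ∀ x, g x ≠ ⊥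

def EConvexOn {E : Type*} [AddCommMonoid E] [SMul ℝ E] (g : E → EReal) : Prop :=
  ∀ x y : E, ∀ a b : ℝ, 0 ≤ a → 0 ≤ b → a + b = 1 →
    g (a • x + b • y) ≤ (a : EReal) * g x + (b : EReal) * g y

def EStrictConvexOn {E : Type*} [AddCommMonoid E] [SMul ℝ E] (g : E → EReal) : Prop :=
  ∀ x y : E, x ≠ y → g x ≠ ⊤ → g y ≠ ⊤ → ∀ a b : ℝ, 0 < a → 0 < b → a + b = 1 →
    g (a • x + b • y) < (a : EReal) * g x + (b : EReal) * g y

/-- Perspective function. -/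
def persp {d : Type*} [Fintype d] (h : (d → ℝ) → EReal) (θ : ℝ) (x : d → ℝ) : EReal :=
  if 0 < θ then (θ : EReal) * h (θ⁻¹ • x)
  else if θ = 0 ∧ x = 0 then 0 else ⊤

/-- The simplex `Δ(S)`. -/
def simplex (n : ℕ) : Set (Fin n → ℝ) :=
  {ρ | (∀ y, ρ y ∈ Set.Icc (0 : ℝ) 1) ∧ ∑ y, ρ y = 1}

abbrev Msp (T n : ℕ) := Fin (T + 1) → Fin n → ℝ
abbrev Wsp (T n : ℕ) := Fin T → Fin n → Fin n → ℝ
abbrev Psp (T : ℕ) := Fin T → ℝ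
abbrev Csp (T n : ℕ) := Msp T n × Wsp T n × Msp T n × Psp T
abbrev Ksp (T n : ℕ) := Msp T n × Msp T n × Psp T
abbrev LSp (T n : ℕ) := Fin T → Fin n → (Fin n → ℝ) → EReal
abbrev FSp (T n : ℕ) := Fin (T + 1) → (Fin n → ℝ) → EReal
abbrev PhiSp (T : ℕ) := Fin T → ℝ → EReal
abbrev ASp (T n : ℕ) := Fin T → Fin n → Fin n → ℝ

variable {T n : ℕ}

def opA (α : ASp T n) (w : Wsp T n) (t : Fin T) : ℝ := ∑ x, ∑ y, w t x y * α t x y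

def opS (w : Wsp T n) (s : Fin (T + 1)) (x : Fin n) : ℝ :=
  if h : (s : ℕ) = 0 then 0
  else ∑ y, w ⟨(s : ℕ) - 1, by have := s.isLt; omega⟩ y x

def mbar0 (m0 : Fin n → ℝ) (s : Fin (T + 1)) (x : Fin n) : ℝ := if s = 0 then m0 x else 0

def Qcpl (α : ASp T n) (m : Msp T n) (π : Wsp T n) (t : Fin T) : ℝ :=
  ∑ x, ∑ y, m t.castSucc x * π t x y * α t x y

def IsKol (m0 : Fin n → ℝ) (π : Wsp T n) (m : Msp T n) : Prop :=
  (∀ x, m 0 x = m0 x) ∧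
    ∀ (t : Fin T) (x : Fin n), m t.succ x = ∑ y, m t.castSucc y * π t y x

def InDelta (π : Wsp T n) : Prop := ∀ t x, π t x ∈ simplex n

def ConvAssumption (ℓ : LSp T n) (F : FSp T n) (φ : PhiSp T) : Prop :=
  (∀ t x, EProper (ℓ t x) ∧ EConvexOn (ℓ t x) ∧ LowerSemicontinuous (ℓ t x) ∧
    ∀ ρ, ℓ t x ρ ≠ ⊤ → ρ ∈ simplex n) ∧
  (∀ s, EProper (F s) ∧ EConvexOn (F s) ∧ LowerSemicontinuous (F s)) ∧
  (∀ t, EProper (φ t) ∧ EConvexOn (φ t) ∧ LowerSemicontinuous (φ t))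

def Jpot (ℓ : LSp T n) (F : FSp T n) (φ : PhiSp T) (α : ASp T n)
    (m : Msp T n) (π : Wsp T n) : EReal :=
  (∑ t, ∑ x, (↑(m t.castSucc x) : EReal) * ℓ t x (π t x)) +
    (∑ t, φ t (Qcpl α m π t)) + ∑ s, F s (m s)

def Jtil (ℓ : LSp T n) (F : FSp T n) (φ : PhiSp T) (α : ASp T n)
    (m : Msp T n) (w : Wsp T n) : EReal :=
  (∑ t, ∑ x, persp (ℓ t x) (m t.castSucc x) (w t x)) +
    (∑ t, φ t (opA α w t)) + ∑ s, F s (m s)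

def FeasP (m0 : Fin n → ℝ) (p : Msp T n × Wsp T n) : Prop := InDelta p.2 ∧ IsKol m0 p.2 p.1

def FeasPt (m0 : Fin n → ℝ) (p : Msp T n × Wsp T n) : Prop :=
  ∀ s x, opS p.2 s x - p.1 s x + mbar0 m0 s x = 0

def valP (ℓ : LSp T n) (F : FSp T n) (φ : PhiSp T) (α : ASp T n) (m0 : Fin n → ℝ) : EReal :=
  ⨅ p ∈ {p : Msp T n × Wsp T n | FeasP m0 p}, Jpot ℓ F φ α p.1 p.2

def valPt (ℓ : LSp T n) (F : FSp T n) (φ : PhiSp T) (α : ASp T n) (m0 : Fin n → ℝ) : EReal :=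
  ⨅ p ∈ {p : Msp T n × Wsp T n | FeasPt m0 p}, Jtil ℓ F φ α p.1 p.2

def IsSolP (ℓ : LSp T n) (F : FSp T n) (φ : PhiSp T) (α : ASp T n) (m0 : Fin n → ℝ)
    (p : Msp T n × Wsp T n) : Prop :=
  FeasP m0 p ∧ ∀ q, FeasP m0 q → Jpot ℓ F φ α p.1 p.2 ≤ Jpot ℓ F φ α q.1 q.2

def IsSolPt (ℓ : LSp T n) (F : FSp T n) (φ : PhiSp T) (α : ASp T n) (m0 : Fin n → ℝ)
    (p : Msp T n × Wsp T n) : Prop :=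
  FeasPt m0 p ∧ ∀ q, FeasPt m0 q → Jtil ℓ F φ α p.1 p.2 ≤ Jtil ℓ F φ α q.1 q.2

def dpCost (ℓ : LSp T n) (α : ASp T n) (u : Msp T n) (P : Psp T)
    (t : Fin T) (x : Fin n) : EReal :=
  conjFn (ℓ t x) (fun y => -(α t x y * P t + u t.succ y))

def FeasD (ℓ : LSp T n) (α : ASp T n) (k : Ksp T n) : Prop :=
  (∀ t x, (↑(k.1 t.castSucc x) : EReal) + dpCost ℓ α k.1 k.2.2 t x ≤ ↑(k.2.1 t.castSucc x)) ∧
  ∀ x, k.1 (Fin.last T) x = k.2.1 (Fin.last T) x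

def Dobj (F : FSp T n) (φ : PhiSp T) (m0 : Fin n → ℝ) (k : Ksp T n) : EReal :=
  (↑(∑ x, m0 x * k.1 0 x) : EReal) - (∑ t, conjR (φ t) (k.2.2 t)) -
    ∑ s, conjFn (F s) (k.2.1 s)

def valD (ℓ : LSp T n) (F : FSp T n) (φ : PhiSp T) (α : ASp T n) (m0 : Fin n → ℝ) : EReal :=
  ⨆ k ∈ {k : Ksp T n | FeasD ℓ α k}, Dobj F φ m0 k

def IsSolD (ℓ : LSp T n) (F : FSp T n) (φ : PhiSp T) (α : ASp T n) (m0 : Fin n → ℝ)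
    (k : Ksp T n) : Prop :=
  FeasD ℓ α k ∧ ∀ k', FeasD ℓ α k' → Dobj F φ m0 k' ≤ Dobj F φ m0 k

/-- `IsDP ℓ α γ P u` : `u = U[γ,P]`, i.e. `u` solves the dynamic programming equation. -/
def IsDP (ℓ : LSp T n) (α : ASp T n) (γ : Msp T n) (P : Psp T) (u : Msp T n) : Prop :=
  (∀ (t : Fin T) (x : Fin n),
    (↑(u t.castSucc x) : EReal) + dpCost ℓ α u P t x = ↑(γ t.castSucc x)) ∧
  ∀ x, u (Fin.last T) x = γ (Fin.last T) x

def valDt (ℓ : LSp T n) (F : FSp T n) (φ : PhiSp T) (α : ASp T n) (m0 : Fin n → ℝ) : EReal :=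
  ⨆ k ∈ {k : Ksp T n | IsDP ℓ α k.2.1 k.2.2 k.1}, Dobj F φ m0 k

def IsSolDt (ℓ : LSp T n) (F : FSp T n) (φ : PhiSp T) (α : ASp T n) (m0 : Fin n → ℝ)
    (γ : Msp T n) (P : Psp T) (u : Msp T n) : Prop :=
  IsDP ℓ α γ P u ∧
    ∀ γ' P' u', IsDP ℓ α γ' P' u' → Dobj F φ m0 (u', γ', P') ≤ Dobj F φ m0 (u, γ, P)

def IsKolPert (m0 : Fin n → ℝ) (ε1 : Msp T n) (π : Wsp T n) (m1 : Msp T n) : Prop :=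
  (∀ x, m1 0 x = mbar0 m0 (0 : Fin (T + 1)) x + ε1 0 x) ∧
  ∀ (t : Fin T) (x : Fin n), m1 t.succ x = (∑ y, m1 t.castSucc y * π t y x) - ε1 t.succ x

def qnorm (ε1 ε2 : Msp T n) (ε3 : Psp T) : ℝ :=
  Real.sqrt ((∑ s, ∑ x, ε1 s x ^ 2) + (∑ s, ∑ x, ε2 s x ^ 2) + ∑ t, ε3 t ^ 2)

def Qualif (ℓ : LSp T n) (F : FSp T n) (φ : PhiSp T) (α : ASp T n) (m0 : Fin n → ℝ) : Prop :=
  ∃ α0 : ℝ, 0 < α0 ∧ ∀ (ε1 ε2 : Msp T n) (ε3 : Psp T), qnorm ε1 ε2 ε3 ≤ α0 →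
    ∃ π : Wsp T n, (∀ t x, ℓ t x (π t x) ≠ ⊤) ∧
      ∃ m1 : Msp T n, IsKolPert m0 ε1 π m1 ∧ (∀ s x, 0 ≤ m1 s x) ∧
        (∀ s, F s (fun x => m1 s x + ε2 s x) ≠ ⊤) ∧
        ∀ t, φ t (Qcpl α m1 π t + ε3 t) ≠ ⊤

def Fobj (ℓ : LSp T n) (F : FSp T n) (φ : PhiSp T) (c : Csp T n) : EReal :=
  (∑ t, ∑ x, persp (ℓ t x) (c.1 t.castSucc x) (c.2.1 t x)) +
    (∑ t, φ t (c.2.2.2 t)) + ∑ s, F s (c.2.2.1 s)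

def Gobj (m0 : Fin n → ℝ) (k : Ksp T n) : EReal :=
  if (∀ s x, k.1 s x = -(mbar0 m0 s x)) ∧ k.2.1 = 0 ∧ k.2.2 = 0 then 0 else ⊤

def Aop (α : ASp T n) (c : Csp T n) : Ksp T n :=
  (fun s x => opS c.2.1 s x - c.1 s x,
   fun s x => c.1 s x - c.2.2.1 s x,
   fun t => opA α c.2.1 t - c.2.2.2 t)

def AstarOp (α : ASp T n) (k : Ksp T n) : Csp T n :=
  (fun s x => k.2.1 s x - k.1 s x,
   fun t x y => α t x y * k.2.2 t + k.1 t.succ y,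
   fun s x => -k.2.1 s x,
   fun t => -k.2.2 t)

def cpair (c c' : Csp T n) : ℝ :=
  (∑ s, ∑ x, c.1 s x * c'.1 s x) + (∑ t, ∑ x, ∑ y, c.2.1 t x y * c'.2.1 t x y) +
    (∑ s, ∑ x, c.2.2.1 s x * c'.2.2.1 s x) + ∑ t, c.2.2.2 t * c'.2.2.2 t

def kpair (k k' : Ksp T n) : ℝ :=
  (∑ s, ∑ x, k.1 s x * k'.1 s x) + (∑ s, ∑ x, k.2.1 s x * k'.2.1 s x) +
    ∑ t, k.2.2 t * k'.2.2 t

def FobjStar (ℓ : LSp T n) (F : FSp T n) (φ : PhiSp T) (c' : Csp T n) : EReal :=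
  ⨆ c : Csp T n, (↑(cpair c c') : EReal) - Fobj ℓ F φ c

def GobjStar (m0 : Fin n → ℝ) (k : Ksp T n) : EReal := ↑(-(∑ x, m0 x * k.1 0 x))

def PfrakObj (ℓ : LSp T n) (F : FSp T n) (φ : PhiSp T) (α : ASp T n) (m0 : Fin n → ℝ)
    (c : Csp T n) : EReal := Fobj ℓ F φ c + Gobj m0 (Aop α c)

def DfrakObj (ℓ : LSp T n) (F : FSp T n) (φ : PhiSp T) (α : ASp T n) (m0 : Fin n → ℝ)
    (k : Ksp T n) : EReal := FobjStar ℓ F φ (-AstarOp α k) + GobjStar m0 k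

def IsSolPfrak (ℓ : LSp T n) (F : FSp T n) (φ : PhiSp T) (α : ASp T n) (m0 : Fin n → ℝ)
    (c : Csp T n) : Prop := ∀ c', PfrakObj ℓ F φ α m0 c ≤ PfrakObj ℓ F φ α m0 c'

def IsSolDfrak (ℓ : LSp T n) (F : FSp T n) (φ : PhiSp T) (α : ASp T n) (m0 : Fin n → ℝ)
    (k : Ksp T n) : Prop := ∀ k', DfrakObj ℓ F φ α m0 k ≤ DfrakObj ℓ F φ α m0 k'

def MFGi (ℓ : LSp T n) (α : ASp T n) (γ : Msp T n) (P : Psp T) (u : Msp T n) : Prop :=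
  (∀ (t : Fin T) (x : Fin n), (↑(u t.castSucc x) : EReal) =
      ⨅ ρ ∈ simplex n,
        ℓ t x ρ + ↑(γ t.castSucc x) + ↑(∑ y, ρ y * (α t x y * P t + u t.succ y))) ∧
  ∀ x, u (Fin.last T) x = γ (Fin.last T) x

def MFGii (ℓ : LSp T n) (α : ASp T n) (π : Wsp T n) (γ : Msp T n) (P : Psp T)
    (u : Msp T n) : Prop :=
  ∀ (t : Fin T) (x : Fin n),
    ℓ t x (π t x) + ↑(γ t.castSucc x) + ↑(∑ y, π t x y * (α t x y * P t + u t.succ y)) =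
      (↑(u t.castSucc x) : EReal)

def IsMFGSol (ℓ : LSp T n) (F : FSp T n) (φ : PhiSp T) (α : ASp T n) (m0 : Fin n → ℝ)
    (m : Msp T n) (π : Wsp T n) (u : Msp T n) (γ : Msp T n) (P : Psp T) : Prop :=
  InDelta π ∧ MFGi ℓ α γ P u ∧ MFGii ℓ α π γ P u ∧ IsKol m0 π m ∧
    (∀ s, γ s ∈ subdiffFn (F s) (m s)) ∧ ∀ t, P t ∈ subdiffR (φ t) (Qcpl α m π t)


/-- Condition (C1): for each `(t,x)`, either the dynamic programming inequality
is (possibly strictly) satisfied and `(m₁(t,x), w(t,x,·)) = (0,0)`, or it holds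
with equality, `m₁(t,x) > 0`, and `π(t,x,·) = w(t,x,·)/m₁(t,x)` satisfies the
Fenchel equality. -/
def C1cond {T n : ℕ} (ℓ : LSp T n) (α : ASp T n) (c : Csp T n) (k : Ksp T n) : Prop :=
  ∀ (t : Fin T) (x : Fin n),
    ((↑(k.1 t.castSucc x) : EReal) + dpCost ℓ α k.1 k.2.2 t x ≤ ↑(k.2.1 t.castSucc x) ∧
      c.1 t.castSucc x = 0 ∧ ∀ y, c.2.1 t x y = 0) ∨
    ((↑(k.1 t.castSucc x) : EReal) + dpCost ℓ α k.1 k.2.2 t x = ↑(k.2.1 t.castSucc x) ∧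
      0 < c.1 t.castSucc x ∧
      ℓ t x (fun y => c.2.1 t x y / c.1 t.castSucc x) + dpCost ℓ α k.1 k.2.2 t x +
        ↑(∑ y, (c.2.1 t x y / c.1 t.castSucc x) * (α t x y * k.2.2 t + k.1 t.succ y)) =
        (0 : EReal))

namespace EReal

theorem finset_sum_ne_bot {ι : Type*} {s : Finset ι} {f : ι → EReal} (h : ∀ i ∈ s, f i ≠ ⊥) :
    ∑ i ∈ s, f i ≠ ⊥ := by
  induction s using Finset.induction_on with
  | empty => simp
  | insert a s ha ih =>
    rw [Finset.sum_insert ha, EReal.add_ne_bot_iff]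
    exact ⟨h a (by simp), ih fun i hi => h i (by simp [hi])⟩

theorem finset_sum_ne_top {ι : Type*} {s : Finset ι} {f : ι → EReal} (h : ∀ i ∈ s, f i ≠ ⊤) :
    ∑ i ∈ s, f i ≠ ⊤ := by
  induction s using Finset.induction_on with
  | empty => simp
  | insert a s ha ih =>
    rw [Finset.sum_insert ha]
    exact EReal.add_ne_top (h a (by simp)) (ih fun i hi => h i (by simp [hi]))

theorem ne_top_of_finset_sum_ne_top {ι : Type*} {s : Finset ι} {f : ι → EReal}
    (hbot : ∀ i ∈ s, f i ≠ ⊥) (h : ∑ i ∈ s, f i ≠ ⊤) {i : ι} (hi : i ∈ s) : f i ≠ ⊤ := by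
  rw [← Finset.add_sum_erase s f hi, EReal.add_ne_top_iff_ne_top₂ (hbot i hi)
    (finset_sum_ne_bot fun j hj => hbot j (Finset.mem_of_mem_erase hj))] at h
  exact h.1

theorem coe_finset_sum {ι : Type*} (s : Finset ι) (f : ι → ℝ) :
    ((∑ i ∈ s, f i : ℝ) : EReal) = ∑ i ∈ s, (f i : EReal) := by
  induction s using Finset.induction_on with
  | empty => simp
  | insert a s ha ih => rw [Finset.sum_insert ha, Finset.sum_insert ha, EReal.coe_add, ih]

theorem le_of_add_le_add_left_of_finite {a b c : EReal} (hbot : a ≠ ⊥) (htop : a ≠ ⊤)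
    (h : a + b ≤ a + c) : b ≤ c := by
  lift a to ℝ using ⟨htop, hbot⟩
  exact EReal.addLECancellable_coe a h

theorem le_of_add_le_add_right_of_finite {a b c : EReal} (hbot : a ≠ ⊥) (htop : a ≠ ⊤)
    (h : b + a ≤ c + a) : b ≤ c := by
  rw [add_comm b, add_comm c] at h
  exact le_of_add_le_add_left_of_finite hbot htop h

/-- If two finite sums differ only in one term, an inequality between them passes to that term. -/
theorem le_of_sum_le_sum_of_eq_of_ne {ι : Type*} [Fintype ι] {f g : ι → EReal} (i : ι)
    (hfg : ∀ j, j ≠ i → g j = f j) (hbot : ∀ j, f j ≠ ⊥) (htop : ∀ j, f j ≠ ⊤)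
    (h : ∑ j, f j ≤ ∑ j, g j) : f i ≤ g i := by
  rw [← Finset.add_sum_erase _ f (Finset.mem_univ i),
    ← Finset.add_sum_erase _ g (Finset.mem_univ i),
    Finset.sum_congr rfl fun j hj => hfg j (Finset.ne_of_mem_erase hj)] at h
  exact le_of_add_le_add_right_of_finite (finset_sum_ne_bot fun j _ => hbot j)
    (finset_sum_ne_top fun j _ => htop j) h

theorem coe_mul_ne_bot_of_nonneg {a : ℝ} (ha : 0 ≤ a) {x : EReal} (hx : x ≠ ⊥) :
    (a : EReal) * x ≠ ⊥ := by
  induction x with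
  | bot => exact absurd rfl hx
  | coe x => exact EReal.coe_ne_bot (a * x)
  | top =>
    rcases ha.eq_or_lt with rfl | ha
    · simp
    · simp [EReal.coe_mul_top_of_pos ha]

theorem coe_mul_ne_top_of_nonneg {a : ℝ} (ha : 0 ≤ a) {x : EReal} (hx : x ≠ ⊤) :
    (a : EReal) * x ≠ ⊤ := by
  induction x with
  | top => exact absurd rfl hx
  | coe x => exact EReal.coe_ne_top (a * x)
  | bot =>
    rcases ha.eq_or_lt with rfl | ha
    · simp
    · simp [EReal.coe_mul_bot_of_pos ha]

theorem coe_mul_add_of_nonneg {a : ℝ} (ha : 0 ≤ a) (x y : EReal) :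
    (a : EReal) * (x + y) = a * x + a * y :=
  EReal.left_distrib_of_nonneg_of_ne_top (EReal.coe_nonneg.2 ha) (EReal.coe_ne_top a) x y

theorem add_coe_sub_le_iff (a b : EReal) (s s' : ℝ) :
    a + ((s' - s : ℝ) : EReal) ≤ b ↔ a + ((-s : ℝ) : EReal) ≤ b + ((-s' : ℝ) : EReal) := by
  induction a with
  | bot => simp only [EReal.bot_add, bot_le]
  | top =>
    rw [EReal.top_add_coe, EReal.top_add_coe]
    induction b with
    | bot => rw [EReal.bot_add]
    | top => rw [EReal.top_add_coe]
    | coe b => rw [← EReal.coe_add]; exact iff_of_false (by simp) (EReal.coe_lt_top _).not_ge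
  | coe a =>
    induction b with
    | bot =>
      rw [EReal.bot_add, ← EReal.coe_add, ← EReal.coe_add]
      exact iff_of_false (EReal.bot_lt_coe _).not_ge (EReal.bot_lt_coe _).not_ge
    | top => rw [EReal.top_add_coe]; simp only [le_top]
    | coe b =>
      norm_cast
      constructor <;> intro h <;> linarith

end EReal

section ConvexFunctions

variable {E E' : Type*} [AddCommGroup E] [Module ℝ E] [AddCommGroup E'] [Module ℝ E']

theorem EConvexOn.add {f g : E → EReal} (hf : EConvexOn f) (hg : EConvexOn g) :
    EConvexOn fun x => f x + g x := by
  intro x y a b ha hb hab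
  refine (add_le_add (hf x y a b ha hb hab) (hg x y a b ha hb hab)).trans_eq ?_
  rw [EReal.coe_mul_add_of_nonneg ha, EReal.coe_mul_add_of_nonneg hb, add_add_add_comm]

theorem EConvexOn.sum {ι : Type*} (s : Finset ι) {f : ι → E → EReal}
    (hf : ∀ i ∈ s, EConvexOn (f i)) : EConvexOn fun x => ∑ i ∈ s, f i x := by
  induction s using Finset.induction_on with
  | empty => intro x y a b _ _ _; simp
  | insert i s hi ih =>
    simp only [Finset.sum_insert hi]
    exact (hf i (by simp)).add (ih fun j hj => hf j (by simp [hj]))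

theorem EConvexOn.comp_linearMap {g : E' → EReal} (hg : EConvexOn g) (L : E →ₗ[ℝ] E') :
    EConvexOn fun x => g (L x) := by
  intro x y a b ha hb hab
  simpa using hg (L x) (L y) a b ha hb hab

theorem persp_ne_bot {d : Type*} [Fintype d] {h : (d → ℝ) → EReal} (hh : ∀ x, h x ≠ ⊥)
    (θ : ℝ) (x : d → ℝ) : persp h θ x ≠ ⊥ := by
  unfold persp
  split_ifs with h1 h2
  · exact EReal.coe_mul_ne_bot_of_nonneg h1.le (hh _)
  · simp
  · simp

theorem persp_zero {d : Type*} [Fintype d] (h : (d → ℝ) → EReal) : persp h 0 0 = 0 := by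
  simp [persp]

theorem persp_of_pos {d : Type*} [Fintype d] (h : (d → ℝ) → EReal) {θ : ℝ} (hθ : 0 < θ)
    (x : d → ℝ) : persp h θ x = θ * h (θ⁻¹ • x) := if_pos hθ

theorem pos_or_eq_zero_of_persp_ne_top {d : Type*} [Fintype d] {h : (d → ℝ) → EReal} {θ : ℝ}
    {x : d → ℝ} (hx : persp h θ x ≠ ⊤) : 0 < θ ∨ (θ = 0 ∧ x = 0) := by
  by_contra! H
  exact hx (by rw [persp, if_neg (not_lt.2 H.1), if_neg fun h' => H.2 h'.1 h'.2])

theorem persp_smul {d : Type*} [Fintype d] (h : (d → ℝ) → EReal) {a : ℝ} (ha : 0 < a) (θ : ℝ)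
    (x : d → ℝ) : persp h (a * θ) (a • x) = a * persp h θ x := by
  unfold persp
  by_cases hθ : 0 < θ
  · rw [if_pos hθ, if_pos (mul_pos ha hθ), EReal.coe_mul, mul_assoc, smul_smul, mul_inv,
      mul_right_comm, inv_mul_cancel₀ ha.ne', one_mul]
  · rw [if_neg hθ, if_neg (by simpa [mul_pos_iff_of_pos_left ha] using hθ)]
    by_cases h0 : θ = 0 ∧ x = 0
    · rw [if_pos h0, if_pos (by simp [h0.1, h0.2]), mul_zero]
    · rw [if_neg h0, if_neg (by simpa [ha.ne'] using h0), EReal.coe_mul_top_of_pos ha]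

/-- The perspective of a convex function is jointly convex. -/
theorem EConvexOn.persp {d : Type*} [Fintype d] {h : (d → ℝ) → EReal} (hh : EConvexOn h)
    (hbot : ∀ x, h x ≠ ⊥) : EConvexOn fun p : ℝ × (d → ℝ) => persp h p.1 p.2 := by
  have subadd : ∀ (θ₁ θ₂ : ℝ) (x₁ x₂ : d → ℝ),
      _root_.persp h (θ₁ + θ₂) (x₁ + x₂) ≤ _root_.persp h θ₁ x₁ + _root_.persp h θ₂ x₂ := by
    intro θ₁ θ₂ x₁ x₂
    by_cases h₁ : _root_.persp h θ₁ x₁ = ⊤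
    · rw [h₁, EReal.top_add_of_ne_bot (persp_ne_bot hbot _ _)]; exact le_top
    by_cases h₂ : _root_.persp h θ₂ x₂ = ⊤
    · rw [h₂, EReal.add_top_of_ne_bot (persp_ne_bot hbot _ _)]; exact le_top
    rcases pos_or_eq_zero_of_persp_ne_top h₁ with hθ₁ | ⟨rfl, rfl⟩
    · rcases pos_or_eq_zero_of_persp_ne_top h₂ with hθ₂ | ⟨rfl, rfl⟩
      · have hθ : 0 < θ₁ + θ₂ := add_pos hθ₁ hθ₂
        rw [persp_of_pos h hθ, persp_of_pos h hθ₁, persp_of_pos h hθ₂]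
        have key := hh (θ₁⁻¹ • x₁) (θ₂⁻¹ • x₂) (θ₁ / (θ₁ + θ₂)) (θ₂ / (θ₁ + θ₂))
          (by positivity) (by positivity) (by field_simp)
        have e : (θ₁ / (θ₁ + θ₂)) • θ₁⁻¹ • x₁ + (θ₂ / (θ₁ + θ₂)) • θ₂⁻¹ • x₂
            = (θ₁ + θ₂)⁻¹ • (x₁ + x₂) := by
          rw [smul_add, smul_smul, smul_smul]
          congr 2 <;> field_simp
        rw [e] at key
        refine (mul_le_mul_of_nonneg_left key (EReal.coe_nonneg.2 hθ.le)).trans_eq ?_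
        rw [EReal.coe_mul_add_of_nonneg hθ.le, ← mul_assoc, ← mul_assoc, ← EReal.coe_mul,
          ← EReal.coe_mul, mul_div_cancel₀ _ hθ.ne', mul_div_cancel₀ _ hθ.ne']
      · simp [persp_zero]
    · simp [persp_zero]
  intro p q a b ha hb hab
  rcases ha.eq_or_lt with rfl | ha
  · obtain rfl : b = 1 := by linarith
    simp
  rcases hb.eq_or_lt with rfl | hb
  · obtain rfl : a = 1 := by linarith
    simp
  have := subadd (a * p.1) (b * q.1) (a • p.2) (b • q.2)
  rwa [persp_smul h ha, persp_smul h hb] at this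

/-- Lagrange multipliers for a convex problem under an affine constraint `L x = L c`, when the
constraint map restricted to the domain of `f` covers a neighbourhood of `L c`. -/
theorem EConvexOn.exists_multiplier {f : E → EReal} (hf : EConvexOn f) (hbot : ∀ x, f x ≠ ⊥)
    (L : E →ₗ[ℝ] E') {c : E} (hc : f c ≠ ⊤) (hmin : ∀ x, L x = L c → f c ≤ f x)
    (habs : ∀ y, ∃ t : ℝ, 0 < t ∧ ∃ x, f x ≠ ⊤ ∧ L x - L c = t • y) :
    ∃ g : E' →ₗ[ℝ] ℝ, ∀ x, f c ≤ f x + (g (L x - L c) : EReal) := by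
  obtain ⟨v, hv⟩ : ∃ v : ℝ, f c = v := ⟨_, (EReal.coe_toReal hc (hbot c)).symm⟩
  let S : Set (E' × ℝ) := {p | ∃ x, L x - L c = p.1 ∧ f x ≤ ((p.2 + v : ℝ) : EReal)}
  have hS : Convex ℝ S := by
    rintro ⟨y₁, r₁⟩ ⟨x₁, h₁, h₁'⟩ ⟨y₂, r₂⟩ ⟨x₂, h₂, h₂'⟩ a b ha hb hab
    refine ⟨a • x₁ + b • x₂, ?_, ?_⟩
    · simp only at h₁ h₂
      simp only [map_add, map_smul, Prod.fst_add, Prod.smul_fst, ← h₁, ← h₂, smul_sub]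
      have : L c = a • L c + b • L c := by rw [← add_smul, hab, one_smul]
      nth_rewrite 1 [this]
      abel
    · refine (hf x₁ x₂ a b ha hb hab).trans ((add_le_add
        (mul_le_mul_of_nonneg_left h₁' (EReal.coe_nonneg.2 ha))
        (mul_le_mul_of_nonneg_left h₂' (EReal.coe_nonneg.2 hb))).trans_eq ?_)
      rw [← EReal.coe_mul, ← EReal.coe_mul, ← EReal.coe_add]
      congr 1
      simp only [Prod.snd_add, Prod.smul_snd, smul_eq_mul]
      linear_combination v * hab
  have hmem : ∀ z, z ∈ ConvexCone.hull ℝ S → ∃ a : ℝ, 0 < a ∧ a • z ∈ S := fun z hz => by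
    obtain ⟨r, hr, hz⟩ := (ConvexCone.mem_hull_of_convex hS).1 hz
    exact ⟨r⁻¹, inv_pos.2 hr, (Set.mem_smul_set_iff_inv_smul_mem₀ hr.ne' _ _).1 hz⟩
  have hpt : (ConvexCone.hull ℝ S).Pointed :=
    ConvexCone.subset_hull (show (0 : E' × ℝ) ∈ S from ⟨c, by simp, by simp [hv]⟩)
  let p : (E' × ℝ) →ₗ.[ℝ] ℝ :=
    ⟨LinearMap.range (LinearMap.inr ℝ E' ℝ),
      (LinearMap.snd ℝ E' ℝ).comp (Submodule.subtype _)⟩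
  have hp : ∀ x : p.domain, (x : E' × ℝ) ∈ (ConvexCone.hull ℝ S).toPointedCone hpt → 0 ≤ p x := by
    rintro ⟨_, ⟨r, rfl⟩⟩ hr
    obtain ⟨a, ha, x, hx, hx'⟩ := hmem _ hr
    have h1 : L x = L c := sub_eq_zero.1 (by simpa using hx)
    have h2 := (hmin x h1).trans hx'
    rw [hv, EReal.coe_le_coe_iff] at h2
    have h3 : 0 ≤ a * r := by simpa using h2
    exact nonneg_of_mul_nonneg_right h3 ha
  have hdense : ∀ y, ∃ x : p.domain,
      (x : E' × ℝ) + y ∈ (ConvexCone.hull ℝ S).toPointedCone hpt := by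
    rintro ⟨y, r⟩
    obtain ⟨t, ht, x, hx, hxy⟩ := habs y
    refine ⟨⟨(0, t⁻¹ * ((f x).toReal - v) - r), ⟨_, rfl⟩⟩, ?_⟩
    refine (ConvexCone.smul_mem_iff _ ht).1 (ConvexCone.subset_hull ⟨x, ?_, ?_⟩)
    · simp [hxy]
    · simp [mul_inv_cancel_left₀ ht.ne', EReal.coe_toReal hx (hbot x)]
  obtain ⟨g, hg, hgS⟩ := riesz_extension _ p hp hdense
  refine ⟨g.comp (LinearMap.inl ℝ E' ℝ), fun x => ?_⟩
  by_cases hx : f x = ⊤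
  · rw [hx, EReal.top_add_coe]; exact le_top
  obtain ⟨r, hr⟩ : ∃ r : ℝ, f x = r := ⟨_, (EReal.coe_toReal hx (hbot x)).symm⟩
  have h1 : 0 ≤ g (L x - L c, r - v) :=
    hgS _ (ConvexCone.subset_hull ⟨x, rfl, by simp [hr]⟩)
  have h2 : g (0, r - v) = r - v := hg ⟨(0, r - v), ⟨r - v, rfl⟩⟩
  have h3 : g (L x - L c, r - v) = g (L x - L c, 0) + g (0, r - v) := by
    rw [← map_add]; simp
  rw [hv, hr, ← EReal.coe_add, EReal.coe_le_coe_iff]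
  simp only [LinearMap.comp_apply, LinearMap.inl_apply]
  linarith

end ConvexFunctions
section Duality

theorem opS_zero (w : Wsp T n) (x : Fin n) : opS w 0 x = 0 := by simp [opS]

theorem opS_succ (w : Wsp T n) (t : Fin T) (x : Fin n) : opS w t.succ x = ∑ y, w t y x := by
  simp [opS]

/-- `Aop α` as a linear map. -/
def AopLin (α : ASp T n) : Csp T n →ₗ[ℝ] Ksp T n where
  toFun := Aop α
  map_add' c c' := by
    refine Prod.ext ?_ (Prod.ext ?_ ?_)
    · funext s x
      refine Fin.cases ?_ (fun t => ?_) s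
      · simp [Aop, opS_zero]; ring
      · simp [Aop, opS_succ, Finset.sum_add_distrib]; ring
    · funext s x; simp [Aop]; ring
    · funext t; simp [Aop, opA, add_mul, Finset.sum_add_distrib]; ring
  map_smul' a c := by
    refine Prod.ext ?_ (Prod.ext ?_ ?_)
    · funext s x
      refine Fin.cases ?_ (fun t => ?_) s
      · simp [Aop, opS_zero]
      · simp [Aop, opS_succ, Finset.mul_sum, mul_sub]
    · funext s x; simp [Aop, mul_sub]
    · funext t; simp [Aop, opA, Finset.mul_sum, mul_sub, mul_assoc]

theorem AopLin_apply (α : ASp T n) (c : Csp T n) : AopLin α c = Aop α c := rfl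

theorem cpair_neg_right (c c' : Csp T n) : cpair c (-c') = -cpair c c' := by
  simp [cpair]; ring

theorem kpair_sub_right (k y y' : Ksp T n) : kpair k (y - y') = kpair k y - kpair k y' := by
  simp [kpair, mul_sub]; ring

theorem kpair_Aop (α : ASp T n) (c : Csp T n) (k : Ksp T n) :
    kpair k (Aop α c) = cpair c (AstarOp α k) := by
  have hS : ∑ s, ∑ x, k.1 s x * opS c.2.1 s x = ∑ t, ∑ x, ∑ y, c.2.1 t x y * k.1 t.succ y := by
    rw [Fin.sum_univ_succ]
    simp only [opS_zero, opS_succ, mul_zero, Finset.sum_const_zero, zero_add, Finset.mul_sum]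
    refine Finset.sum_congr rfl fun t _ => ?_
    rw [Finset.sum_comm]
    simp only [mul_comm]
  have hA : ∑ t, k.2.2 t * opA α c.2.1 t
      = ∑ t, ∑ x, ∑ y, c.2.1 t x y * (α t x y * k.2.2 t) := by
    simp only [opA, Finset.mul_sum]
    refine Finset.sum_congr rfl fun t _ => Finset.sum_congr rfl fun x _ =>
      Finset.sum_congr rfl fun y _ => by ring
  simp only [kpair, Aop, cpair, AstarOp, mul_sub, mul_add, Finset.sum_sub_distrib,
    Finset.sum_add_distrib, hS, hA, mul_neg, Finset.sum_neg_distrib]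
  simp only [mul_comm (k.1 _ _) (c.1 _ _), mul_comm (k.2.1 _ _) (c.1 _ _),
    mul_comm (k.2.1 _ _) (c.2.2.1 _ _), mul_comm (k.2.2 _) (c.2.2.2 _)]
  ring

theorem exists_eq_kpair (g : Ksp T n →ₗ[ℝ] ℝ) : ∃ k, ∀ y, g y = kpair k y := by
  have hM : ∀ h : Msp T n →ₗ[ℝ] ℝ, ∃ a : Msp T n, ∀ y, h y = ∑ s, ∑ x, a s x * y s x := by
    intro h
    refine ⟨fun s x => h (Pi.single s (Pi.single x 1)), fun y => ?_⟩
    have hy : y = ∑ s, ∑ x, y s x • (Pi.single s (Pi.single x 1) : Msp T n) := by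
      funext s x
      simp [Finset.sum_apply, Pi.single_apply, ite_apply]
    conv_lhs => rw [hy]
    simp [map_sum, mul_comm]
  obtain ⟨a, ha⟩ := hM (g.comp (LinearMap.inl ℝ _ _))
  obtain ⟨b, hb⟩ := hM (g.comp ((LinearMap.inr ℝ _ _).comp (LinearMap.inl ℝ _ _)))
  refine ⟨(a, b, fun t => g (0, 0, Pi.single t 1)), fun y => ?_⟩
  have hy : y = (y.1, 0, 0) + (0, y.2.1, 0) + ∑ t, y.2.2 t • ((0, 0, Pi.single t 1) : Ksp T n) := by
    refine Prod.ext ?_ (Prod.ext ?_ ?_)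
    · simp [Prod.fst_sum]
    · simp [Prod.snd_sum, Prod.fst_sum]
    · funext t
      simp [Prod.snd_sum, Finset.sum_apply, Pi.single_apply]
  have h1 := ha y.1
  have h2 := hb y.2.1
  simp only [LinearMap.comp_apply, LinearMap.inl_apply, LinearMap.inr_apply] at h1 h2
  conv_lhs => rw [hy]
  rw [map_add, map_add, map_sum]
  simp only [kpair, map_smul, smul_eq_mul]
  rw [← h1, ← h2]
  simp [mul_comm, Prod.mk_zero_zero]

theorem Gobj_eq_zero_iff (m0 : Fin n → ℝ) (α : ASp T n) (c : Csp T n) :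
    Gobj m0 (Aop α c) = 0 ↔
      (∀ s x, c.1 s x = opS c.2.1 s x + mbar0 m0 s x) ∧ c.1 = c.2.2.1 ∧
        ∀ t, c.2.2.2 t = opA α c.2.1 t := by
  have h : Gobj m0 (Aop α c) = 0 ↔ (∀ s x, (Aop α c).1 s x = -(mbar0 m0 s x)) ∧
      (Aop α c).2.1 = 0 ∧ (Aop α c).2.2 = 0 := by
    unfold Gobj
    split_ifs with h <;> simp [h]
  rw [h]
  simp only [Aop, funext_iff, Pi.zero_apply, sub_eq_zero]
  refine and_congr (forall₂_congr fun s x => ?_) (and_congr Iff.rfl (forall_congr' fun t => eq_comm))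
  constructor <;> intro h <;> linarith

theorem Gobj_eq_zero_or_top (m0 : Fin n → ℝ) (y : Ksp T n) : Gobj m0 y = 0 ∨ Gobj m0 y = ⊤ := by
  unfold Gobj
  split_ifs <;> simp

theorem eq_of_Gobj_eq_zero {m0 : Fin n → ℝ} {y : Ksp T n} (h : Gobj m0 y = 0) :
    y = (fun s x => -(mbar0 m0 s x), 0, 0) := by
  unfold Gobj at h
  split_ifs at h with h'
  · exact Prod.ext (funext₂ h'.1) (Prod.ext h'.2.1 h'.2.2)
  · simp at h

theorem GobjStar_eq_of_Gobj_eq_zero {m0 : Fin n → ℝ} {y : Ksp T n} (h : Gobj m0 y = 0)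
    (k : Ksp T n) : GobjStar m0 k = (kpair k y : EReal) := by
  rw [eq_of_Gobj_eq_zero h, GobjStar]
  congr 1
  simp [kpair, mbar0, mul_comm]

variable {ℓ : LSp T n} {F : FSp T n} {φ : PhiSp T} {α : ASp T n} {m0 : Fin n → ℝ}

theorem Fobj_ne_bot (hconv : ConvAssumption ℓ F φ) (c : Csp T n) : Fobj ℓ F φ c ≠ ⊥ := by
  obtain ⟨hℓ, hF, hφ⟩ := hconv
  refine EReal.add_ne_bot_iff.2 ⟨EReal.add_ne_bot_iff.2 ⟨?_, ?_⟩, ?_⟩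
  · exact EReal.finset_sum_ne_bot fun t _ => EReal.finset_sum_ne_bot fun x _ =>
      persp_ne_bot (hℓ t x).1.2 _ _
  · exact EReal.finset_sum_ne_bot fun t _ => (hφ t).1.2 _
  · exact EReal.finset_sum_ne_bot fun s _ => (hF s).1.2 _

theorem Fobj_convex (hconv : ConvAssumption ℓ F φ) : EConvexOn (Fobj ℓ F φ) := by
  obtain ⟨hℓ, hF, hφ⟩ := hconv
  refine ((EConvexOn.sum _ fun t _ => EConvexOn.sum _ fun x _ => ?_).add
    (EConvexOn.sum _ fun t _ => ?_)).add (EConvexOn.sum _ fun s _ => ?_)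
  · exact ((hℓ t x).2.1.persp (hℓ t x).1.2).comp_linearMap
      (((LinearMap.proj x).comp ((LinearMap.proj t.castSucc).comp (LinearMap.fst ℝ _ _))).prod
        ((LinearMap.proj x).comp ((LinearMap.proj t).comp
          ((LinearMap.fst ℝ _ _).comp (LinearMap.snd ℝ (Msp T n) (Wsp T n × Msp T n × Psp T))))))
  · exact (hφ t).2.1.comp_linearMap ((LinearMap.proj t).comp ((LinearMap.snd ℝ _ _).comp
      ((LinearMap.snd ℝ _ _).comp (LinearMap.snd ℝ (Msp T n) (Wsp T n × Msp T n × Psp T)))))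
  · exact (hF s).2.1.comp_linearMap ((LinearMap.proj s).comp ((LinearMap.fst ℝ _ _).comp
      ((LinearMap.snd ℝ _ _).comp (LinearMap.snd ℝ (Msp T n) (Wsp T n × Msp T n × Psp T)))))

theorem exists_pos_qnorm_smul_le (y : Ksp T n) {a : ℝ} (ha : 0 < a) :
    ∃ t : ℝ, 0 < t ∧ qnorm (t • y.1) (t • y.2.1) (t • y.2.2) ≤ a := by
  have hq : 0 ≤ qnorm y.1 y.2.1 y.2.2 := Real.sqrt_nonneg _
  refine ⟨a / (qnorm y.1 y.2.1 y.2.2 + 1), by positivity, ?_⟩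
  have hs : ∀ t : ℝ, 0 ≤ t →
      qnorm (t • y.1) (t • y.2.1) (t • y.2.2) = t * qnorm y.1 y.2.1 y.2.2 := by
    intro t ht
    simp only [qnorm]
    rw [← Real.sqrt_sq (mul_nonneg ht (Real.sqrt_nonneg _)), mul_pow, Real.sq_sqrt (by positivity)]
    simp [mul_pow, Finset.mul_sum, mul_add]
  rw [hs _ (by positivity), div_mul_eq_mul_div, div_le_iff₀ (by positivity)]
  nlinarith

/-- The qualification assumption says that the constraint residual of points in the domain of
`Fobj` covers every direction. -/
theorem Qualif.exists_smul_eq (hqual : Qualif ℓ F φ α m0) (y : Ksp T n) :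
    ∃ t : ℝ, 0 < t ∧ ∃ c, Fobj ℓ F φ c ≠ ⊤ ∧
      Aop α c = (fun s x => -(mbar0 m0 s x), 0, 0) + t • y := by
  obtain ⟨a, ha, H⟩ := hqual
  let z : Ksp T n := (fun s x => if s = 0 then -y.1 s x else y.1 s x, -y.2.1, -y.2.2)
  obtain ⟨t, ht, hq⟩ := exists_pos_qnorm_smul_le z ha
  obtain ⟨π, hπ, m1, ⟨hm0, hm⟩, hpos, hF, hφ⟩ := H _ _ _ hq
  refine ⟨t, ht, (m1, fun t x y => m1 t.castSucc x * π t x y, m1 + t • z.2.1,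
    fun s => Qcpl α m1 π s + (t • z.2.2) s), ?_, ?_⟩
  · refine EReal.add_ne_top (EReal.add_ne_top ?_ ?_) ?_
    · refine EReal.finset_sum_ne_top fun s _ => EReal.finset_sum_ne_top fun x _ => ?_
      rcases (hpos s.castSucc x).eq_or_lt with h0 | h0
      · simp [← h0, persp, funext_iff]
      · have : (m1 s.castSucc x)⁻¹ • (fun y => m1 s.castSucc x * π s x y) = π s x := by
          funext y; simp [h0.ne']
        simp only [persp_of_pos _ h0]
        rw [this]
        exact EReal.coe_mul_ne_top_of_nonneg h0.le (hπ s x)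
    · exact EReal.finset_sum_ne_top fun s _ => hφ s
    · exact EReal.finset_sum_ne_top fun s _ => hF s
  · refine Prod.ext ?_ (Prod.ext ?_ ?_)
    · funext s x
      refine Fin.cases ?_ (fun s => ?_) s
      · simp [Aop, opS_zero, hm0, z, mbar0, add_comm]
      · simp [Aop, opS_succ, hm, z, mbar0, Fin.succ_ne_zero]
    · funext s x; simp [Aop, z]
    · funext s; simp [Aop, opA, Qcpl, z]

theorem Fobj_add_cpair_le_iff (hconv : ConvAssumption ℓ F φ) {c : Csp T n} {k : Ksp T n}
    (hG : Gobj m0 (Aop α c) = 0) (hc : Fobj ℓ F φ c ≠ ⊤) :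
    DfrakObj ℓ F φ α m0 k ≤ -Fobj ℓ F φ c ↔
      ∀ x, Fobj ℓ F φ c + (cpair c (AstarOp α k) : EReal)
        ≤ Fobj ℓ F φ x + (cpair x (AstarOp α k) : EReal) := by
  have hb := Fobj_ne_bot hconv
  obtain ⟨v, hv⟩ : ∃ v : ℝ, Fobj ℓ F φ c = v := ⟨_, (EReal.coe_toReal hc (hb c)).symm⟩
  rw [DfrakObj, GobjStar_eq_of_Gobj_eq_zero hG, kpair_Aop, hv,
    ← EReal.le_sub_iff_add_le (by simp) (by simp), FobjStar, iSup_le_iff]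
  refine forall_congr' fun x => ?_
  rw [cpair_neg_right]
  induction h : Fobj ℓ F φ x with
  | bot => exact absurd h (hb x)
  | top => simp
  | coe r =>
    norm_cast
    constructor <;> intro h <;> linarith

/-- Optimality of a primal-dual pair is equivalent to primal feasibility together with
minimality of `c` for the Lagrangian. -/
theorem isSolPfrak_and_isSolDfrak_iff (hconv : ConvAssumption ℓ F φ) (hqual : Qualif ℓ F φ α m0)
    (c : Csp T n) (k : Ksp T n) :
    IsSolPfrak ℓ F φ α m0 c ∧ IsSolDfrak ℓ F φ α m0 k ↔
      Gobj m0 (Aop α c) = 0 ∧ Fobj ℓ F φ c ≠ ⊤ ∧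
        ∀ x, Fobj ℓ F φ c + (cpair c (AstarOp α k) : EReal)
          ≤ Fobj ℓ F φ x + (cpair x (AstarOp α k) : EReal) := by
  have hb := Fobj_ne_bot hconv
  constructor
  · rintro ⟨hP, hD⟩
    obtain ⟨_, _, x₀, hx₀, hx₀'⟩ := hqual.exists_smul_eq 0
    have hx₀G : Gobj m0 (Aop α x₀) = 0 := by simp [hx₀', Gobj]
    have hlt : PfrakObj ℓ F φ α m0 c ≠ ⊤ := by
      refine ((hP x₀).trans_lt ?_).ne
      rw [PfrakObj, hx₀G, add_zero]
      exact hx₀.lt_top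
    have hG : Gobj m0 (Aop α c) = 0 := by
      refine (Gobj_eq_zero_or_top m0 _).resolve_right fun h => hlt ?_
      rw [PfrakObj, h, EReal.add_top_of_ne_bot (hb c)]
    have hc : Fobj ℓ F φ c ≠ ⊤ := by rwa [PfrakObj, hG, add_zero] at hlt
    refine ⟨hG, hc, (Fobj_add_cpair_le_iff hconv hG hc).1 ?_⟩
    obtain ⟨g, hg⟩ := (Fobj_convex hconv).exists_multiplier hb (AopLin α) hc
      (fun x hx => by
        have := hP x
        rw [AopLin_apply, AopLin_apply] at hx
        rwa [PfrakObj, PfrakObj, hx, hG, add_zero, add_zero] at this)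
      (fun y => by
        obtain ⟨t, ht, x, hx, hxy⟩ := hqual.exists_smul_eq (α := α) y
        refine ⟨t, ht, x, hx, ?_⟩
        rw [AopLin_apply, AopLin_apply, hxy, eq_of_Gobj_eq_zero hG, add_sub_cancel_left])
    obtain ⟨k₀, hk₀⟩ := exists_eq_kpair g
    refine (hD k₀).trans ((Fobj_add_cpair_le_iff hconv hG hc).2 fun x => ?_)
    have := add_le_add_left (hg x) (cpair c (AstarOp α k₀) : EReal)
    rwa [add_assoc, ← EReal.coe_add, hk₀, AopLin_apply, AopLin_apply, kpair_sub_right, kpair_Aop,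
      kpair_Aop, sub_add_cancel] at this
  · rintro ⟨hG, hc, hmin⟩
    refine ⟨fun x => ?_, fun k' => ?_⟩
    · rw [PfrakObj, PfrakObj, hG, add_zero]
      rcases Gobj_eq_zero_or_top m0 (Aop α x) with h | h
      · rw [h, add_zero]
        have := hmin x
        rw [← kpair_Aop, ← kpair_Aop, eq_of_Gobj_eq_zero h, eq_of_Gobj_eq_zero hG] at this
        exact EReal.le_of_add_le_add_right_of_finite (EReal.coe_ne_bot _) (EReal.coe_ne_top _) this
      · rw [h, EReal.add_top_of_ne_bot (hb x)]
        exact le_top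
    · refine ((Fobj_add_cpair_le_iff hconv hG hc).2 hmin).trans ?_
      obtain ⟨v, hv⟩ : ∃ v : ℝ, Fobj ℓ F φ c = v := ⟨_, (EReal.coe_toReal hc (hb c)).symm⟩
      rw [DfrakObj, GobjStar_eq_of_Gobj_eq_zero hG, kpair_Aop, FobjStar]
      refine le_trans ?_ (add_le_add_left (le_iSup _ c) _)
      rw [hv, cpair_neg_right]
      norm_cast
      linarith

end Duality

section LocalConditions

theorem mem_subdiffFn_iff {d : Type*} [Fintype d] {g : (d → ℝ) → EReal} {x p : d → ℝ} :
    p ∈ subdiffFn g x ↔ g x ≠ ⊤ ∧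
      ∀ x', g x + ((-∑ i, x i * p i : ℝ) : EReal) ≤ g x' + ((-∑ i, x' i * p i : ℝ) : EReal) := by
  refine and_congr Iff.rfl (forall_congr' fun x' => ?_)
  have e : ∑ i, p i * (x' i - x i) = ∑ i, x' i * p i - ∑ i, x i * p i := by
    rw [← Finset.sum_sub_distrib]
    exact Finset.sum_congr rfl fun i _ => by ring
  rw [e]
  exact EReal.add_coe_sub_le_iff _ _ _ _

theorem mem_subdiffR_iff {g : ℝ → EReal} {x p : ℝ} :
    p ∈ subdiffR g x ↔ g x ≠ ⊤ ∧
      ∀ x', g x + ((-(x * p) : ℝ) : EReal) ≤ g x' + ((-(x' * p) : ℝ) : EReal) := by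
  refine and_congr Iff.rfl (forall_congr' fun x' => ?_)
  rw [mul_sub, mul_comm p, mul_comm p]
  exact EReal.add_coe_sub_le_iff _ _ _ _

variable {d : Type*} [Fintype d] {h : (d → ℝ) → EReal}

theorem add_conjFn_le_iff (hbot : ∀ x, h x ≠ ⊥) (u γ : ℝ) (q : d → ℝ) :
    (u : EReal) + conjFn h (fun y => -q y) ≤ γ ↔
      ∀ ρ, 0 ≤ h ρ + ((γ - u + ∑ y, ρ y * q y : ℝ) : EReal) := by
  rw [add_comm, ← EReal.le_sub_iff_add_le (by simp) (by simp), conjFn, iSup_le_iff]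
  refine forall_congr' fun ρ => ?_
  simp only [mul_neg, Finset.sum_neg_distrib]
  have hρ := hbot ρ
  revert hρ
  generalize h ρ = r
  intro hρ
  induction r with
  | bot => exact absurd rfl hρ
  | top => rw [EReal.top_add_coe]; simp
  | coe r =>
    norm_cast
    constructor <;> intro h <;> linarith

/-- The perspective of `h` tilted by the linear form `(θ, w) ↦ a θ + ⟨w, q⟩`. -/
def tiltedPersp (h : (d → ℝ) → EReal) (a : ℝ) (q : d → ℝ) (θ : ℝ) (w : d → ℝ) : EReal :=
  persp h θ w + ((θ * a + ∑ y, w y * q y : ℝ) : EReal)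

theorem tiltedPersp_smul (a : ℝ) (q : d → ℝ) {b : ℝ} (hb : 0 < b) (θ : ℝ) (w : d → ℝ) :
    tiltedPersp h a q (b * θ) (b • w) = b * tiltedPersp h a q θ w := by
  rw [tiltedPersp, tiltedPersp, persp_smul h hb, EReal.coe_mul_add_of_nonneg hb.le, ← EReal.coe_mul]
  congr 2
  simp only [Pi.smul_apply, smul_eq_mul, mul_add, Finset.mul_sum, mul_assoc]

theorem tiltedPersp_zero (a : ℝ) (q : d → ℝ) : tiltedPersp h a q 0 0 = 0 := by
  simp [tiltedPersp, persp_zero]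

theorem tiltedPersp_one (a : ℝ) (q ρ : d → ℝ) :
    tiltedPersp h a q 1 ρ = h ρ + ((a + ∑ y, ρ y * q y : ℝ) : EReal) := by
  simp [tiltedPersp, persp_of_pos]

theorem tiltedPersp_of_pos (a : ℝ) (q : d → ℝ) {θ : ℝ} (hθ : 0 < θ) (w : d → ℝ) :
    tiltedPersp h a q θ w =
      θ * (h (fun y => w y / θ) + ((a + ∑ y, w y / θ * q y : ℝ) : EReal)) := by
  rw [← tiltedPersp_one, ← tiltedPersp_smul a q hθ, mul_one]
  congr 1
  funext y
  simp [mul_div_cancel₀ _ hθ.ne']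

theorem tiltedPersp_nonneg {a : ℝ} {q : d → ℝ}
    (H : ∀ ρ, 0 ≤ h ρ + ((a + ∑ y, ρ y * q y : ℝ) : EReal)) (θ : ℝ) (w : d → ℝ) :
    0 ≤ tiltedPersp h a q θ w := by
  by_cases ht : persp h θ w = ⊤
  · rw [tiltedPersp, ht, EReal.top_add_coe]; exact le_top
  rcases pos_or_eq_zero_of_persp_ne_top ht with hθ | ⟨rfl, rfl⟩
  · rw [tiltedPersp_of_pos a q hθ]
    exact mul_nonneg (EReal.coe_nonneg.2 hθ.le) (H _)
  · rw [tiltedPersp_zero]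

theorem tiltedPersp_minimal_iff (hbot : ∀ x, h x ≠ ⊥) (u γ : ℝ) (q : d → ℝ) (θ : ℝ) (w : d → ℝ) :
    (persp h θ w ≠ ⊤ ∧
        ∀ θ' w', tiltedPersp h (γ - u) q θ w ≤ tiltedPersp h (γ - u) q θ' w') ↔
      ((u : EReal) + conjFn h (fun y => -q y) ≤ γ ∧ θ = 0 ∧ ∀ y, w y = 0) ∨
      ((u : EReal) + conjFn h (fun y => -q y) = γ ∧ 0 < θ ∧
        h (fun y => w y / θ) + conjFn h (fun y => -q y) + ((∑ y, w y / θ * q y : ℝ) : EReal)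
          = 0) := by
  constructor
  · rintro ⟨hfin, hmin⟩
    have hV0 : tiltedPersp h (γ - u) q θ w = 0 := by
      refine le_antisymm ((hmin 0 0).trans_eq (tiltedPersp_zero _ _)) ?_
      have h2 := hmin (2 * θ) ((2 : ℝ) • w)
      rw [tiltedPersp_smul _ _ two_pos] at h2
      have hb : tiltedPersp h (γ - u) q θ w ≠ ⊥ :=
        EReal.add_ne_bot_iff.2 ⟨persp_ne_bot hbot _ _, EReal.coe_ne_bot _⟩
      have ht : tiltedPersp h (γ - u) q θ w ≠ ⊤ := EReal.add_ne_top hfin (EReal.coe_ne_top _)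
      lift tiltedPersp h (γ - u) q θ w to ℝ using ⟨ht, hb⟩ with V
      norm_cast at h2 ⊢
      linarith
    have hle : (u : EReal) + conjFn h (fun y => -q y) ≤ γ := by
      refine (add_conjFn_le_iff hbot u γ q).2 fun ρ => ?_
      rw [← tiltedPersp_one, ← hV0]
      exact hmin 1 ρ
    rcases pos_or_eq_zero_of_persp_ne_top hfin with hθ | ⟨hθ, hw⟩
    · refine Or.inr ?_
      rw [tiltedPersp_of_pos _ _ hθ, mul_eq_zero, or_iff_right (by simpa using hθ.ne')] at hV0
      have hconj : (((∑ y, w y / θ * -q y : ℝ) : EReal) - h fun y => w y / θ)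
          ≤ conjFn h (fun y => -q y) := le_iSup (fun x => ((∑ y, x y * -q y : ℝ) : EReal) - h x) _
      simp only [mul_neg, Finset.sum_neg_distrib] at hconj
      have hπ := hbot fun y => w y / θ
      generalize h (fun y => w y / θ) = r at *
      generalize conjFn h (fun y => -q y) = v at *
      induction r with
      | bot => exact absurd rfl hπ
      | top => rw [EReal.top_add_coe] at hV0; exact absurd hV0 (by simp)
      | coe r =>
        induction v with
        | bot => norm_cast at hconj
        | top => simp at hle
        | coe v =>
          norm_cast at *
          refine ⟨?_, hθ, ?_⟩ <;> linarith
    · exact Or.inl ⟨hle, hθ, fun y => by rw [hw]; rfl⟩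
  · rintro (⟨hle, rfl, hw⟩ | ⟨heq, hθ, hF⟩)
    · obtain rfl : w = 0 := funext hw
      refine ⟨by simp [persp_zero], fun θ' w' => ?_⟩
      rw [tiltedPersp_zero]
      exact tiltedPersp_nonneg ((add_conjFn_le_iff hbot u γ q).1 hle) θ' w'
    · have hle := (add_conjFn_le_iff hbot u γ q).1 heq.le
      have hπ : h (fun y => w y / θ) + ((γ - u + ∑ y, w y / θ * q y : ℝ) : EReal) = 0 := by
        generalize h (fun y => w y / θ) = r at *
        generalize conjFn h (fun y => -q y) = v at *
        induction v with
        | bot => simp at heq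
        | top => simp at heq
        | coe v =>
          induction r with
          | bot => simp at hF
          | top => norm_cast at hF
          | coe r => norm_cast at *; linarith
      have hV0 : tiltedPersp h (γ - u) q θ w = 0 := by
        rw [tiltedPersp_of_pos _ _ hθ, hπ, mul_zero]
      refine ⟨fun ht => ?_, fun θ' w' => hV0.trans_le (tiltedPersp_nonneg hle θ' w')⟩
      rw [tiltedPersp, ht, EReal.top_add_coe] at hV0
      exact absurd hV0 (by simp)

end LocalConditions

section Separation

variable {ℓ : LSp T n} {F : FSp T n} {φ : PhiSp T} {α : ASp T n}

theorem Fobj_add_cpair_eq (x : Csp T n) (k : Ksp T n) :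
    Fobj ℓ F φ x + (cpair x (AstarOp α k) : EReal) =
      (∑ p : Fin T × Fin n, tiltedPersp (ℓ p.1 p.2)
        (k.2.1 p.1.castSucc p.2 - k.1 p.1.castSucc p.2)
        (fun y => α p.1 p.2 y * k.2.2 p.1 + k.1 p.1.succ y)
        (x.1 p.1.castSucc p.2) (x.2.1 p.1 p.2)) +
      (∑ t, (φ t (x.2.2.2 t) + ((-(x.2.2.2 t * k.2.2 t) : ℝ) : EReal))) +
      (∑ s, (F s (x.2.2.1 s) + ((-∑ y, x.2.2.1 s y * k.2.1 s y : ℝ) : EReal))) +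
      ((∑ y, x.1 (Fin.last T) y * (k.2.1 (Fin.last T) y - k.1 (Fin.last T) y) : ℝ) : EReal) := by
  have e : cpair x (AstarOp α k) =
      (∑ p : Fin T × Fin n, (x.1 p.1.castSucc p.2 *
        (k.2.1 p.1.castSucc p.2 - k.1 p.1.castSucc p.2) +
        ∑ y, x.2.1 p.1 p.2 y * (α p.1 p.2 y * k.2.2 p.1 + k.1 p.1.succ y))) +
      (∑ t, -(x.2.2.2 t * k.2.2 t)) + (∑ s, -∑ y, x.2.2.1 s y * k.2.1 s y) +
      ∑ y, x.1 (Fin.last T) y * (k.2.1 (Fin.last T) y - k.1 (Fin.last T) y) := by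
    simp only [cpair, AstarOp, Fintype.sum_prod_type, Finset.sum_add_distrib, mul_neg,
      Finset.sum_neg_distrib]
    rw [Fin.sum_univ_castSucc]
    ring
  rw [e, Fobj]
  simp only [tiltedPersp, Finset.sum_add_distrib (M := EReal), EReal.coe_add, EReal.coe_finset_sum,
    ← Fintype.sum_prod_type' (f := fun t y => persp (ℓ t y) (x.1 t.castSucc y) (x.2.1 t y))]
  ac_rfl

theorem Fobj_ne_top_iff (hconv : ConvAssumption ℓ F φ) (c : Csp T n) :
    Fobj ℓ F φ c ≠ ⊤ ↔ (∀ t x, persp (ℓ t x) (c.1 t.castSucc x) (c.2.1 t x) ≠ ⊤) ∧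
      (∀ t, φ t (c.2.2.2 t) ≠ ⊤) ∧ ∀ s, F s (c.2.2.1 s) ≠ ⊤ := by
  have hb := Fobj_ne_bot hconv c
  obtain ⟨hℓ, hF, hφ⟩ := hconv
  have hp := fun t x => persp_ne_bot (hℓ t x).1.2 (c.1 t.castSucc x) (c.2.1 t x)
  constructor
  · intro h
    rw [Fobj] at h hb
    obtain ⟨hb, hb3⟩ := EReal.add_ne_bot_iff.1 hb
    obtain ⟨hb1, hb2⟩ := EReal.add_ne_bot_iff.1 hb
    obtain ⟨h, h3⟩ := (EReal.add_ne_top_iff_ne_top₂ hb hb3).1 h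
    obtain ⟨h1, h2⟩ := (EReal.add_ne_top_iff_ne_top₂ hb1 hb2).1 h
    refine ⟨fun t x => ?_, fun t => ?_, fun s => ?_⟩
    · exact EReal.ne_top_of_finset_sum_ne_top (fun x _ => hp t x)
        (EReal.ne_top_of_finset_sum_ne_top
          (fun t _ => EReal.finset_sum_ne_bot fun x _ => hp t x) h1 (Finset.mem_univ t))
        (Finset.mem_univ x)
    · exact EReal.ne_top_of_finset_sum_ne_top (fun t _ => (hφ t).1.2 _) h2 (Finset.mem_univ t)
    · exact EReal.ne_top_of_finset_sum_ne_top (fun s _ => (hF s).1.2 _) h3 (Finset.mem_univ s)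
  · rintro ⟨h1, h2, h3⟩
    exact EReal.add_ne_top (EReal.add_ne_top
      (EReal.finset_sum_ne_top fun t _ => EReal.finset_sum_ne_top fun x _ => h1 t x)
      (EReal.finset_sum_ne_top fun t _ => h2 t)) (EReal.finset_sum_ne_top fun s _ => h3 s)

/-- Minimality for the Lagrangian decouples into minimality of each of its terms. -/
theorem lagrangian_minimal_iff (hconv : ConvAssumption ℓ F φ) (c : Csp T n) (k : Ksp T n) :
    (Fobj ℓ F φ c ≠ ⊤ ∧ ∀ x, Fobj ℓ F φ c + (cpair c (AstarOp α k) : EReal)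
        ≤ Fobj ℓ F φ x + (cpair x (AstarOp α k) : EReal)) ↔
      C1cond ℓ α c k ∧ (∀ x, k.1 (Fin.last T) x = k.2.1 (Fin.last T) x) ∧
      (∀ s, k.2.1 s ∈ subdiffFn (F s) (c.2.2.1 s)) ∧
      (∀ t, k.2.2 t ∈ subdiffR (φ t) (c.2.2.2 t)) := by
  have hC1 : C1cond ℓ α c k ↔ ∀ t x, persp (ℓ t x) (c.1 t.castSucc x) (c.2.1 t x) ≠ ⊤ ∧
      ∀ θ' w', tiltedPersp (ℓ t x) (k.2.1 t.castSucc x - k.1 t.castSucc x)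
          (fun y => α t x y * k.2.2 t + k.1 t.succ y) (c.1 t.castSucc x) (c.2.1 t x) ≤
        tiltedPersp (ℓ t x) (k.2.1 t.castSucc x - k.1 t.castSucc x)
          (fun y => α t x y * k.2.2 t + k.1 t.succ y) θ' w' :=
    forall₂_congr fun t x => (tiltedPersp_minimal_iff (hconv.1 t x).1.2 _ _ _ _ _).symm
  simp only [hC1, mem_subdiffFn_iff, mem_subdiffR_iff, Fobj_ne_top_iff hconv]
  constructor
  · rintro ⟨⟨hp, hφ, hF⟩, hmin⟩
    have hN : ∀ p : Fin T × Fin n, ∃ r : ℝ, tiltedPersp (ℓ p.1 p.2)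
        (k.2.1 p.1.castSucc p.2 - k.1 p.1.castSucc p.2)
        (fun y => α p.1 p.2 y * k.2.2 p.1 + k.1 p.1.succ y)
        (c.1 p.1.castSucc p.2) (c.2.1 p.1 p.2) = r := fun p =>
      ⟨_, (EReal.coe_toReal (EReal.add_ne_top (hp _ _) (EReal.coe_ne_top _))
        (EReal.add_ne_bot_iff.2 ⟨persp_ne_bot (hconv.1 _ _).1.2 _ _, EReal.coe_ne_bot _⟩)).symm⟩
    have hφ' : ∀ t, ∃ r : ℝ,
        φ t (c.2.2.2 t) + ((-(c.2.2.2 t * k.2.2 t) : ℝ) : EReal) = r := fun t =>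
      ⟨_, (EReal.coe_toReal (EReal.add_ne_top (hφ _) (EReal.coe_ne_top _))
        (EReal.add_ne_bot_iff.2 ⟨(hconv.2.2 _).1.2 _, EReal.coe_ne_bot _⟩)).symm⟩
    have hF' : ∀ s, ∃ r : ℝ,
        F s (c.2.2.1 s) + ((-∑ y, c.2.2.1 s y * k.2.1 s y : ℝ) : EReal) = r := fun s =>
      ⟨_, (EReal.coe_toReal (EReal.add_ne_top (hF _) (EReal.coe_ne_top _))
        (EReal.add_ne_bot_iff.2 ⟨(hconv.2.1 _).1.2 _, EReal.coe_ne_bot _⟩)).symm⟩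
    choose N hN using hN
    choose Φ hΦ using hφ'
    choose Ψ hΨ using hF'
    simp only [Fobj_add_cpair_eq, hN, hΦ, hΨ] at hmin
    refine ⟨fun t x => ⟨hp t x, fun θ w => ?_⟩, ?_, fun s => ⟨hF s, fun m => ?_⟩,
      fun t => ⟨hφ t, fun D => ?_⟩⟩
    · have := hmin (Function.update c.1 t.castSucc (Function.update (c.1 t.castSucc) x θ),
        Function.update c.2.1 t (Function.update (c.2.1 t) x w), c.2.2)
      simp only [hΦ, hΨ, Function.update_of_ne (Fin.castSucc_lt_last t).ne'] at this
      rw [← EReal.coe_finset_sum, ← EReal.coe_finset_sum, ← EReal.coe_finset_sum] at this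
      have := EReal.le_of_add_le_add_right_of_finite (by simp) (by simp)
        (EReal.le_of_add_le_add_right_of_finite (by simp) (by simp)
        (EReal.le_of_add_le_add_right_of_finite (by simp) (by simp) this))
      rw [EReal.coe_finset_sum] at this
      have := EReal.le_of_sum_le_sum_of_eq_of_ne (t, x) ?_ (by simp) (by simp) this
      · simpa [← hN] using this
      · rintro ⟨t', x'⟩ hne
        rw [← hN]
        by_cases ht : t' = t
        · subst ht
          have hx : x' ≠ x := fun h => hne (by rw [h])
          simp [Function.update_of_ne hx]
        · simp [Function.update_of_ne ht,
            Function.update_of_ne (fun h => ht (Fin.castSucc_injective _ h))]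
    · have := hmin (Function.update c.1 (Fin.last T) fun x => c.1 (Fin.last T) x -
        (k.2.1 (Fin.last T) x - k.1 (Fin.last T) x), c.2)
      simp only [Function.update_of_ne (Fin.castSucc_lt_last _).ne, hN, hΦ, hΨ,
        Function.update_self, ← EReal.coe_finset_sum, ← EReal.coe_add, EReal.coe_le_coe_iff,
        sub_mul, Finset.sum_sub_distrib] at this
      have h0 : ∑ x, (k.2.1 (Fin.last T) x - k.1 (Fin.last T) x) *
          (k.2.1 (Fin.last T) x - k.1 (Fin.last T) x) = 0 := by
        refine le_antisymm ?_ (Finset.sum_nonneg fun x _ => mul_self_nonneg _)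
        simp only [sub_mul, Finset.sum_sub_distrib]
        linarith
      intro x
      have := (Finset.sum_eq_zero_iff_of_nonneg fun x _ => mul_self_nonneg _).1 h0 x
        (Finset.mem_univ x)
      linarith [mul_self_eq_zero.1 this]
    · have := hmin (c.1, c.2.1, Function.update c.2.2.1 s m, c.2.2.2)
      simp only [hN, hΦ] at this
      rw [← EReal.coe_finset_sum, ← EReal.coe_finset_sum, ← EReal.coe_add] at this
      have := EReal.le_of_add_le_add_left_of_finite (EReal.coe_ne_bot _) (EReal.coe_ne_top _)
        (EReal.le_of_add_le_add_right_of_finite (by simp) (by simp) this)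
      have := EReal.le_of_sum_le_sum_of_eq_of_ne s ?_ (by simp) (by simp) this
      · simpa only [← hΨ, Function.update_self] using this
      · intro s' hs
        rw [← hΨ, Function.update_of_ne hs]
    · have := hmin (c.1, c.2.1, c.2.2.1, Function.update c.2.2.2 t D)
      simp only [hN, hΨ] at this
      rw [← EReal.coe_finset_sum, ← EReal.coe_finset_sum univ Ψ] at this
      have := EReal.le_of_add_le_add_left_of_finite (by simp) (by simp)
        (EReal.le_of_add_le_add_right_of_finite (by simp) (by simp)
        (EReal.le_of_add_le_add_right_of_finite (by simp) (by simp) this))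
      have := EReal.le_of_sum_le_sum_of_eq_of_ne t ?_ (by simp) (by simp) this
      · simpa only [← hΦ, Function.update_self] using this
      · intro t' ht
        rw [← hΦ, Function.update_of_ne ht]
  · rintro ⟨h1, h2, h3, h4⟩
    refine ⟨⟨fun t x => (h1 t x).1, fun t => (h4 t).1, fun s => (h3 s).1⟩, fun x => ?_⟩
    rw [Fobj_add_cpair_eq, Fobj_add_cpair_eq]
    refine add_le_add (add_le_add (add_le_add ?_ ?_) ?_) ?_
    · exact Finset.sum_le_sum fun p _ => (h1 p.1 p.2).2 _ _
    · exact Finset.sum_le_sum fun t _ => (h4 t).2 _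
    · exact Finset.sum_le_sum fun s _ => (h3 s).2 _
    · simp [h2]

end Separation

/-- Lemma 6: `(m₁,w,m₂,D)` and `(u,γ,P)` are respectively
solutions of (𝔓) and (𝔇) if and only if conditions (C1)–(C7) hold. -/
theorem optimality_conditions_C1_C7 {T n : ℕ} (hT : 1 ≤ T) (hn : 1 ≤ n)
    (ℓ : LSp T n) (F : FSp T n) (φ : PhiSp T) (α : ASp T n)
    (m0 : Fin n → ℝ) (hm0 : m0 ∈ simplex n)
    (hconv : ConvAssumption ℓ F φ) (hqual : Qualif ℓ F φ α m0)
    (c : Csp T n) (k : Ksp T n) :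
    (IsSolPfrak ℓ F φ α m0 c ∧ IsSolDfrak ℓ F φ α m0 k) ↔
    (C1cond ℓ α c k ∧
     (∀ x, k.1 (Fin.last T) x = k.2.1 (Fin.last T) x) ∧
     (∀ s, k.2.1 s ∈ subdiffFn (F s) (c.2.2.1 s)) ∧
     (∀ t, k.2.2 t ∈ subdiffR (φ t) (c.2.2.2 t)) ∧
     (∀ s x, c.1 s x = opS c.2.1 s x + mbar0 m0 s x) ∧
     (c.1 = c.2.2.1) ∧
     (∀ t, c.2.2.2 t = opA α c.2.1 t)) := by
  rw [isSolPfrak_and_isSolDfrak_iff hconv hqual, lagrangian_minimal_iff hconv, Gobj_eq_zero_iff]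
  tauto

end
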